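/- Let χ ≥ 3 and m ≥ R⃗(χ) be integers, and let H = H(TT_χ, m). Then, for every integer n ≥ 3, R(P_{n,2}^{(3)}, H) ≥ ((2/3)n - 3)(R⃗(χ) - 1) + 1. -/

import Mathlib

open scoped Classical

/-- There is a copy of the hypergraph with edge set `F` all of whose edges receive
colour `b` under the red/blue colouring `c` (`true` = red, `false` = blue) of the
complete hypergraph on the vertex type `V`. -/
def hasMonoCopy {V W : Type*} [DecidableEq V] [DecidableEq W]
    (c : Finset V → Bool) (b : Bool) (F : Finset (Finset W)) : Prop :=
  ∃ f : W → V, Function.Injective f ∧ ∀ e ∈ F, c (e.image f) = b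

/-- The Ramsey number of a pair of hypergraphs: the least `N` such that every
red/blue colouring of the complete hypergraph on `N` vertices contains a red copy
of `G` or a blue copy of `H`. -/
noncomputable def ramseyNumber {V W : Type*} [DecidableEq V] [DecidableEq W]
    (G : Finset (Finset V)) (H : Finset (Finset W)) : ℕ :=
  sInf {N : ℕ | ∀ c : Finset (Fin N) → Bool,
    hasMonoCopy c true G ∨ hasMonoCopy c false H}

/-- `E` is a `k`-uniform hypergraph: every edge has exactly `k` vertices. -/
def IsUniformHyp {V : Type*} (k : ℕ) (E : Finset (Finset V)) : Prop :=
  ∀ e ∈ E, e.card = k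
/-- The edge set of the `k`-uniform `ℓ`-path on `n` vertices `0, …, n-1`
(for `n ≡ ℓ (mod k-ℓ)`): the `i`-th edge consists of the vertices
`i(k-ℓ), …, i(k-ℓ)+k-1`. -/
def ellPathEdges (k ℓ n : ℕ) : Finset (Finset (Fin n)) :=
  (Finset.range ((n - ℓ) / (k - ℓ))).image (fun i =>
    Finset.univ.filter (fun v : Fin n => i * (k - ℓ) ≤ (v : ℕ) ∧ (v : ℕ) < i * (k - ℓ) + k))
/-- A tournament: an orientation of the complete graph. -/
def IsTournament {V : Type*} (T : V → V → Prop) : Prop :=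
  (∀ v, ¬ T v v) ∧ ∀ u v : V, u ≠ v → (T u v ↔ ¬ T v u)

/-- The tournament `T` contains a copy of the transitive tournament on `ℓ` vertices. -/
def ContainsTransTourn {V : Type*} (T : V → V → Prop) (ℓ : ℕ) : Prop :=
  ∃ f : Fin ℓ → V, Function.Injective f ∧ ∀ i j : Fin ℓ, i < j → T (f i) (f j)

/-- `R⃗(ℓ)`: the least `N` such that every tournament on at least `N` vertices
contains a transitive tournament on `ℓ` vertices. -/
noncomputable def dirRamsey (ℓ : ℕ) : ℕ :=
  sInf {N : ℕ | ∀ M : ℕ, N ≤ M → ∀ T : Fin M → Fin M → Prop,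
    IsTournament T → ContainsTransTourn T ℓ}
/-- The tournament hypergraph `H(TT_χ, m)` associated to the transitive tournament
on `[χ]` (with arcs `i → j` for `i < j`), with vertex classes `{i} × Fin m`:
its edges are the triples with two vertices in class `i` and one in class `j`,
where `i < j`. -/
def transTournHyp (χ m : ℕ) : Finset (Finset (Fin χ × Fin m)) :=
  Finset.univ.filter (fun e : Finset (Fin χ × Fin m) =>
    ∃ x ∈ e, ∃ y ∈ e, ∃ z ∈ e, x ≠ y ∧ e = {x, y, z} ∧ x.1 = y.1 ∧ x.1 < z.1)

theorem ramsey_aux (r : ℕ) : ∀ L : ℕ, ∃ N : ℕ, ∀ (α : Type) [LinearOrder α] (S : Finset α),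
    N ≤ S.card → ∀ c : Finset α → Bool, ∃ T ⊆ S, T.card = L ∧
      ∃ b, ∀ e ⊆ T, e.card = r → c e = b := by
  induction r with
  | zero =>
    intro L
    refine ⟨L, fun α _ S hS c => ?_⟩
    obtain ⟨T, hT, hc⟩ := Finset.exists_subset_card_eq hS
    refine ⟨T, hT, hc, c ∅, fun e _ he => ?_⟩
    rw [Finset.card_eq_zero.1 he]
  | succ r ih =>
    have key : ∀ k : ℕ, ∃ N : ℕ, ∀ (α : Type) [LinearOrder α] (S : Finset α),
        N ≤ S.card → ∀ c : Finset α → Bool, ∃ T ⊆ S, T.card = k ∧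
          ∃ d : α → Bool, ∀ v ∈ T, ∀ e ⊆ T, e.card = r → (∀ w ∈ e, v < w) →
            c (insert v e) = d v := by
      intro k
      induction k with
      | zero =>
        refine ⟨0, fun α _ S _ c => ⟨∅, by simp, by simp, fun _ => true, by simp⟩⟩
      | succ k ihk =>
        obtain ⟨Nk, hNk⟩ := ihk
        obtain ⟨N, hN⟩ := ih Nk
        refine ⟨N + 1, fun α _ S hS c => ?_⟩
        have hne : S.Nonempty := Finset.card_pos.1 (by omega)
        set v := S.min' hne with hv
        have hvS : v ∈ S := Finset.min'_mem _ _
        obtain ⟨T', hT', hc', b, hb⟩ := hN α (S.erase v)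
          (by rw [Finset.card_erase_of_mem hvS]; omega) (fun e => c (insert v e))
        obtain ⟨T, hT, hc, d, hd⟩ := hNk α T' hc'.ge c
        have hlt : ∀ w ∈ T, v < w := by
          intro w hw
          have h1 := hT' (hT hw)
          rw [Finset.mem_erase] at h1
          exact lt_of_le_of_ne (Finset.min'_le _ _ h1.2) (Ne.symm h1.1)
        have hvT : v ∉ T := fun h => lt_irrefl _ (hlt v h)
        refine ⟨insert v T, ?_, ?_, fun x => if x = v then b else d x, ?_⟩
        · intro x hx
          rcases Finset.mem_insert.1 hx with rfl | hx
          · exact hvS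
          · exact Finset.mem_of_mem_erase (hT' (hT hx))
        · rw [Finset.card_insert_of_notMem hvT, hc]
        · intro x hx e he hec hxe
          have hve : v ∉ e := by
            intro h
            have h2 := hxe v h
            rcases Finset.mem_insert.1 hx with rfl | hx
            · exact lt_irrefl _ h2
            · exact lt_asymm h2 (hlt x hx)
          have heT : e ⊆ T := (Finset.subset_insert_iff_of_notMem hve).1 he
          rcases Finset.mem_insert.1 hx with hx | hx
          · rw [hx]
            simp only [if_true]
            exact hb e (heT.trans hT) hec
          · have : x ≠ v := fun h => hvT (h ▸ hx)
            simp only [this, if_false]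
            exact hd x hx e heT hec hxe
    intro L
    obtain ⟨N, hN⟩ := key (2 * L)
    refine ⟨N, fun α _ S hS c => ?_⟩
    obtain ⟨T, hT, hc, d, hd⟩ := hN α S hS c
    have : ∃ b, L ≤ (T.filter (fun x => d x = b)).card := by
      by_contra! h
      have h1 := h true
      have h2 := h false
      have h3 := Finset.card_filter_add_card_filter_not (s := T) (fun x => d x = true)
      simp only [Bool.not_eq_true] at h3
      omega
    obtain ⟨b, hb⟩ := this
    obtain ⟨U, hU, hUc⟩ := Finset.exists_subset_card_eq hb
    refine ⟨U, fun x hx => hT (Finset.mem_filter.1 (hU hx)).1, hUc, b, fun e he hec => ?_⟩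
    have hne : e.Nonempty := Finset.card_pos.1 (by omega)
    have hm := e.min'_mem hne
    have h1 := Finset.mem_filter.1 (hU (he hm))
    rw [← Finset.insert_erase hm, hd _ h1.1 _ _ _ _, h1.2]
    · intro x hx
      exact (Finset.mem_filter.1 (hU (he (Finset.mem_of_mem_erase hx)))).1
    · rw [Finset.card_erase_of_mem hm]; omega
    · intro w hw
      exact Finset.min'_lt_of_mem_erase_min' _ _ hw

theorem dirRamsey_mem (ℓ : ℕ) : ∀ M : ℕ, dirRamsey ℓ ≤ M → ∀ T : Fin M → Fin M → Prop,
    IsTournament T → ContainsTransTourn T ℓ := by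
  have : (dirRamsey ℓ) ∈ {N : ℕ | ∀ M : ℕ, N ≤ M → ∀ T : Fin M → Fin M → Prop,
      IsTournament T → ContainsTransTourn T ℓ} := by
    apply Nat.sInf_mem
    obtain ⟨N, hN⟩ := ramsey_aux 2 ℓ
    refine ⟨N, fun M hM T hT => ?_⟩
    obtain ⟨U, -, hUc, b, hb⟩ := hN (Fin M) Finset.univ (by simpa using hM)
      (fun e => decide (∃ u v, e = {u, v} ∧ u < v ∧ T u v))
    have hmem : ∀ i, U.orderEmbOfFin hUc i ∈ U := fun i => Finset.orderEmbOfFin_mem _ _ _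
    have hT2 : ∀ u ∈ U, ∀ v ∈ U, u < v → (T u v ↔ b = true) := by
      intro u hu v hv huv
      have h := hb {u, v} (by intro x; simp; rintro (rfl | rfl) <;> assumption)
        (Finset.card_pair huv.ne)
      rw [← h, decide_eq_true_iff]
      constructor
      · intro h; exact ⟨u, v, rfl, huv, h⟩
      · rintro ⟨u', v', he, hlt, h⟩
        have h1 : u ∈ ({u', v'} : Finset (Fin M)) := he ▸ (by simp)
        have h2 : v ∈ ({u', v'} : Finset (Fin M)) := he ▸ (by simp)
        simp only [Finset.mem_insert, Finset.mem_singleton] at h1 h2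
        rcases h1 with rfl | rfl <;> rcases h2 with rfl | rfl
        · exact absurd huv (lt_irrefl _)
        · exact h
        · exact absurd huv (lt_asymm hlt)
        · exact absurd huv (lt_irrefl _)
    cases b with
    | true =>
      refine ⟨U.orderEmbOfFin hUc, (U.orderEmbOfFin hUc).injective, fun i j hij => ?_⟩
      exact (hT2 _ (hmem i) _ (hmem j) ((U.orderEmbOfFin hUc).strictMono hij)).2 rfl
    | false =>
      refine ⟨fun i => U.orderEmbOfFin hUc i.rev,
        fun i j h => Fin.rev_injective ((U.orderEmbOfFin hUc).injective h), fun i j hij => ?_⟩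
      have hlt := (U.orderEmbOfFin hUc).strictMono (Fin.rev_lt_rev.2 hij)
      rw [hT.2 _ _ hlt.ne']
      rw [hT2 _ (hmem _) _ (hmem _) hlt]
      simp
  exact this

theorem exists_bad_tourn (ℓ : ℕ) (hℓ : 1 ≤ ℓ) : 1 ≤ dirRamsey ℓ ∧
    ∃ T : Fin (dirRamsey ℓ - 1) → Fin (dirRamsey ℓ - 1) → Prop,
      IsTournament T ∧ ¬ ContainsTransTourn T ℓ := by
  have h1 : 1 ≤ dirRamsey ℓ := by
    by_contra h
    obtain ⟨f, -⟩ := dirRamsey_mem ℓ 0 (by omega) (fun _ _ => False)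
      ⟨fun v => v.elim0, fun v => v.elim0⟩
    exact (f ⟨0, hℓ⟩).elim0
  refine ⟨h1, ?_⟩
  by_contra! h
  have : dirRamsey ℓ - 1 ∈ {N : ℕ | ∀ M : ℕ, N ≤ M → ∀ T : Fin M → Fin M → Prop,
      IsTournament T → ContainsTransTourn T ℓ} := by
    intro M hM
    by_cases hM' : dirRamsey ℓ ≤ M
    · exact dirRamsey_mem ℓ M hM'
    · obtain rfl : M = dirRamsey ℓ - 1 := by omega
      exact h
  have h2 : dirRamsey ℓ ≤ dirRamsey ℓ - 1 := Nat.sInf_le this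
  omega

theorem path_edge (n i : ℕ) (hi : i + 2 < n) :
    ({⟨i, by omega⟩, ⟨i + 1, by omega⟩, ⟨i + 2, hi⟩} : Finset (Fin n)) ∈ ellPathEdges 3 2 n := by
  unfold ellPathEdges
  rw [Finset.mem_image]
  refine ⟨i, by simp; omega, ?_⟩
  ext v
  simp [Fin.ext_iff]
  omega

theorem path_card (n : ℕ) : ∀ e ∈ ellPathEdges 3 2 n, e.card = 3 := by
  intro e he
  unfold ellPathEdges at he
  rw [Finset.mem_image] at he
  obtain ⟨i, hi, rfl⟩ := he
  simp at hi
  rw [Finset.card_eq_three]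
  refine ⟨⟨i, by omega⟩, ⟨i + 1, by omega⟩, ⟨i + 2, by omega⟩, by simp, by simp, by simp, ?_⟩
  ext v
  simp [Fin.ext_iff]
  omega

theorem tourn_card (χ m : ℕ) : ∀ e ∈ transTournHyp χ m, e.card = 3 := by
  intro e he
  unfold transTournHyp at he
  rw [Finset.mem_filter] at he
  obtain ⟨-, x, -, y, -, z, -, hxy, rfl, h1, h2⟩ := he
  rw [Finset.card_eq_three]
  refine ⟨x, y, z, hxy, ?_, ?_, rfl⟩
  · rintro rfl; exact lt_irrefl _ h2
  · rintro rfl; exact lt_irrefl _ (h1 ▸ h2)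

theorem copy_of_homog {N L : ℕ} (c : Finset (Fin N) → Bool) (U : Finset (Fin N))
    (hU : U.card = L) (b : Bool) (hb : ∀ e ⊆ U, e.card = 3 → c e = b)
    {W : Type*} [Fintype W] [DecidableEq W] (F : Finset (Finset W)) (hF : ∀ e ∈ F, e.card = 3)
    (hW : Fintype.card W ≤ L) : hasMonoCopy c b F := by
  have : Nonempty (W ↪ U) := by
    apply Function.Embedding.nonempty_of_card_le
    simpa [hU] using hW
  obtain ⟨g⟩ := this
  have hinj : Function.Injective (fun w => (g w : Fin N)) :=
    fun a b h => g.injective (Subtype.ext h)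
  refine ⟨fun w => g w, hinj, fun e he => ?_⟩
  apply hb
  · intro x hx
    obtain ⟨w, -, rfl⟩ := Finset.mem_image.1 hx
    exact (g w).2
  · rw [Finset.card_image_of_injective _ hinj, hF e he]

theorem ramsey_mem (n χ m : ℕ) :
    ∀ c : Finset (Fin (ramseyNumber (ellPathEdges 3 2 n) (transTournHyp χ m))) → Bool,
    hasMonoCopy c true (ellPathEdges 3 2 n) ∨ hasMonoCopy c false (transTournHyp χ m) := by
  have : ramseyNumber (ellPathEdges 3 2 n) (transTournHyp χ m) ∈
      {N : ℕ | ∀ c : Finset (Fin N) → Bool,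
    hasMonoCopy c true (ellPathEdges 3 2 n) ∨ hasMonoCopy c false (transTournHyp χ m)} := by
    apply Nat.sInf_mem
    obtain ⟨N, hN⟩ := ramsey_aux 3 (n + χ * m)
    refine ⟨N, fun c => ?_⟩
    obtain ⟨U, -, hUc, b, hb⟩ := hN (Fin N) Finset.univ (by simp) c
    cases b with
    | true => exact Or.inl (copy_of_homog c U hUc true hb _ (path_card n) (by simp))
    | false => exact Or.inr (copy_of_homog c U hUc false hb _ (tourn_card χ m) (by simp))
  exact this

/-- colour-`i` red triple in terms of classes -/
def redTriple {k : ℕ} (T : Fin k → Fin k → Prop) (i a b c : Fin k) : Prop :=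
  ((a = i ∧ b = i) ∨ (a = i ∧ c = i) ∨ (b = i ∧ c = i)) ∧
  (a = i ∨ T a i) ∧ (b = i ∨ T b i) ∧ (c = i ∨ T c i)

def redSet {k N : ℕ} (T : Fin k → Fin k → Prop) (cls : Fin N → Fin k)
    (e : Finset (Fin N)) : Prop :=
  ∃ i, (∃ x ∈ e, ∃ y ∈ e, x ≠ y ∧ cls x = i ∧ cls y = i) ∧ ∀ z ∈ e, cls z = i ∨ T (cls z) i

theorem redSet_triple {k N : ℕ} (T : Fin k → Fin k → Prop) (cls : Fin N → Fin k)
    (a b c : Fin N) (h : redSet T cls {a, b, c}) :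
    ∃ i, redTriple T i (cls a) (cls b) (cls c) := by
  obtain ⟨i, ⟨x, hx, y, hy, hxy, h1, h2⟩, h3⟩ := h
  refine ⟨i, ?_, h3 a (by simp), h3 b (by simp), h3 c (by simp)⟩
  simp only [Finset.mem_insert, Finset.mem_singleton] at hx hy
  rcases hx with rfl | rfl | rfl <;> rcases hy with rfl | rfl | rfl <;> simp_all

theorem redTriple_step {k : ℕ} (T : Fin k → Fin k → Prop) (hT : IsTournament T)
    {i j a b c d : Fin k} (h1 : redTriple T i a b c) (h2 : redTriple T j b c d) : i = j := by
  by_contra hij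
  have h3 := hT.2 i j hij
  unfold redTriple at h1 h2
  grind

theorem no_red {k N n : ℕ} (hn : 3 ≤ n) (T : Fin k → Fin k → Prop) (hT : IsTournament T)
    (cls : Fin N → Fin k)
    (hcls : ∀ i, (Finset.univ.filter (fun v => cls v = i)).card < 2 * (n / 3))
    (f : Fin n → Fin N) (hf : Function.Injective f)
    (hred : ∀ e ∈ ellPathEdges 3 2 n, redSet T cls (e.image f)) : False := by
  have h1 : ∀ t (ht : t + 2 < n), ∃ i, redTriple T i (cls (f ⟨t, by omega⟩))
      (cls (f ⟨t + 1, by omega⟩)) (cls (f ⟨t + 2, ht⟩)) := by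
    intro t ht
    apply redSet_triple
    have := hred _ (path_edge n t ht)
    simpa [Finset.image_insert] using this
  obtain ⟨i, hi⟩ := h1 0 (by omega)
  have h2 : ∀ t (ht : t + 2 < n), redTriple T i (cls (f ⟨t, by omega⟩))
      (cls (f ⟨t + 1, by omega⟩)) (cls (f ⟨t + 2, ht⟩)) := by
    intro t
    induction t with
    | zero => intro ht; exact hi
    | succ t ih =>
      intro ht
      have h3 := ih (by omega)
      obtain ⟨j, hj⟩ := h1 (t + 1) ht
      have := redTriple_step T hT h3 hj
      subst this
      exact hj
  let p : ℕ → Prop := fun v => ∃ h : v < n, cls (f ⟨v, h⟩) = i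
  have h3 : ∀ q, 3 * q ≤ n → 2 * q ≤ ((Finset.range (3 * q)).filter p).card := by
    intro q
    induction q with
    | zero => simp
    | succ q ih =>
      intro hq
      have ih := ih (by omega)
      have h4 := (h2 (3 * q) (by omega)).1
      have e : 3 * (q + 1) = 3 * q + 1 + 1 + 1 := by ring
      have p0 : p (3 * q) ↔ cls (f ⟨3 * q, by omega⟩) = i :=
        ⟨fun ⟨_, h⟩ => h, fun h => ⟨_, h⟩⟩
      have p1 : p (3 * q + 1) ↔ cls (f ⟨3 * q + 1, by omega⟩) = i :=
        ⟨fun ⟨_, h⟩ => h, fun h => ⟨_, h⟩⟩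
      have p2 : p (3 * q + 1 + 1) ↔ cls (f ⟨3 * q + 2, by omega⟩) = i :=
        ⟨fun ⟨_, h⟩ => h, fun h => ⟨_, h⟩⟩
      rw [← p0, ← p1, ← p2] at h4
      rw [← Nat.count_eq_card_filter_range] at ih ⊢
      rw [e, Nat.count_succ, Nat.count_succ, Nat.count_succ]
      rcases h4 with ⟨a, b⟩ | ⟨a, b⟩ | ⟨a, b⟩ <;> rw [if_pos a, if_pos b] <;> omega
  have h4 := h3 (n / 3) (by omega)
  have h5 := hcls i
  have h6 : ((Finset.range (3 * (n / 3))).filter p).card ≤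
      (Finset.univ.filter (fun v => cls v = i)).card := by
    have hn0 : 0 < n := by omega
    apply Finset.card_le_card_of_injOn
      (fun v => if h : v < n then f ⟨v, h⟩ else f ⟨0, hn0⟩)
    · intro v hv
      simp only [Finset.coe_filter, Set.mem_ofPred_eq] at hv
      obtain ⟨-, h, h'⟩ := hv
      simp [h, h']
    · intro v hv w hw hvw
      simp only [Finset.coe_filter, Set.mem_ofPred_eq] at hv hw
      obtain ⟨-, h, -⟩ := hv
      obtain ⟨-, h', -⟩ := hw
      simp only [h, h', dif_pos] at hvw
      simpa using hf hvw
  omega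

theorem no_blue {k N χ m : ℕ} (hm : k < m) (T : Fin k → Fin k → Prop) (hT : IsTournament T)
    (hTT : ¬ ContainsTransTourn T χ) (cls : Fin N → Fin k)
    (f : Fin χ × Fin m → Fin N) (hf : Function.Injective f)
    (hblue : ∀ e ∈ transTournHyp χ m, ¬ redSet T cls (e.image f)) : False := by
  have h1 : ∀ a : Fin χ, ∃ x y : Fin m, x ≠ y ∧ cls (f (a, x)) = cls (f (a, y)) := by
    intro a
    exact Fintype.exists_ne_map_eq_of_card_lt (fun x : Fin m => cls (f (a, x))) (by simpa using hm)
  choose x y hxy hc using h1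
  have key : ∀ a b : Fin χ, a < b → T (cls (f (a, x a))) (cls (f (b, x b))) := by
    intro a b hab
    have hmem : ({(a, x a), (a, y a), (b, x b)} : Finset (Fin χ × Fin m)) ∈
        transTournHyp χ m := by
      unfold transTournHyp
      rw [Finset.mem_filter]
      exact ⟨Finset.mem_univ _, (a, x a), by simp, (a, y a), by simp, (b, x b), by simp,
        by simp [hxy a], rfl, rfl, hab⟩
    by_contra hcon
    apply hblue _ hmem
    refine ⟨cls (f (a, x a)), ⟨f (a, x a), Finset.mem_image_of_mem _ (by simp),
      f (a, y a), Finset.mem_image_of_mem _ (by simp), fun h => hxy a (by simpa using hf h),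
      rfl, (hc a).symm⟩, ?_⟩
    intro z hz
    obtain ⟨w, hw, rfl⟩ := Finset.mem_image.1 hz
    simp only [Finset.mem_insert, Finset.mem_singleton] at hw
    rcases hw with rfl | rfl | rfl
    · exact Or.inl rfl
    · exact Or.inl (hc a).symm
    · by_cases h : cls (f (b, x b)) = cls (f (a, x a))
      · exact Or.inl h
      · exact Or.inr ((hT.2 _ _ h).2 hcon)
  apply hTT
  refine ⟨fun a => cls (f (a, x a)), fun a b hab => ?_, key⟩
  by_contra hne
  rcases lt_or_gt_of_ne hne with h | h
  · have := key a b h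
    simp only at hab
    rw [hab] at this
    exact hT.1 _ this
  · have := key b a h
    simp only at hab
    rw [hab] at this
    exact hT.1 _ this

theorem nat_bound (χ m n : ℕ) (hχ : 3 ≤ χ) (hm : dirRamsey χ ≤ m) (hn : 3 ≤ n) :
    (2 * (n / 3) - 1) * (dirRamsey χ - 1) < ramseyNumber (ellPathEdges 3 2 n) (transTournHyp χ m) := by
  by_contra! hle
  obtain ⟨hR, T, hT, hTT⟩ := exists_bad_tourn χ (by omega)
  have hmem := ramsey_mem n χ m
  generalize ramseyNumber (ellPathEdges 3 2 n) (transTournHyp χ m) = N at hle hmem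
  have hspos : 0 < 2 * (n / 3) - 1 := by omega
  have hsn : 2 * (n / 3) - 1 < 2 * (n / 3) := by omega
  generalize 2 * (n / 3) - 1 = s at hle hspos hsn
  let cls : Fin N → Fin (dirRamsey χ - 1) := fun v =>
    ⟨v / s, (Nat.div_lt_iff_lt_mul hspos).2 (by rw [mul_comm]; exact lt_of_lt_of_le v.2 hle)⟩
  have hcls : ∀ i, (Finset.univ.filter (fun v => cls v = i)).card < 2 * (n / 3) := by
    intro i
    refine lt_of_le_of_lt ?_ hsn
    have : (Finset.univ.filter (fun v => cls v = i)).card ≤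
        (Finset.Ico (i * s : ℕ) (i * s + s)).card := by
      apply Finset.card_le_card_of_injOn (fun v : Fin N => (v : ℕ))
      · intro v hv
        simp only [Finset.coe_filter, Finset.mem_univ, true_and, Set.mem_ofPred_eq] at hv
        have h1 : (v : ℕ) / s = i := congrArg Fin.val hv
        rw [Finset.coe_Ico, Set.mem_Ico, ← h1]
        have h2 := Nat.div_add_mod (v : ℕ) s
        have h3 := Nat.mod_lt (v : ℕ) hspos
        rw [mul_comm] at h2
        show (v : ℕ) / s * s ≤ (v : ℕ) ∧ (v : ℕ) < (v : ℕ) / s * s + s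
        generalize (v : ℕ) / s * s = q at *
        omega
      · intro v _ w _ h
        exact Fin.ext h
    simpa using this
  rcases hmem (fun e => decide (redSet T cls e)) with ⟨f, hf, h⟩ | ⟨f, hf, h⟩
  · exact no_red hn T hT cls hcls f hf (fun e he => by simpa using h e he)
  · exact no_blue (by omega) T hT hTT cls f hf (fun e he => by simpa using h e he)

theorem tightPath_transitive_lower (χ m : ℕ) (hχ : 3 ≤ χ) (hm : dirRamsey χ ≤ m) :
    ∀ n : ℕ, 3 ≤ n →
      ((2 : ℝ) / 3 * n - 3) * ((dirRamsey χ : ℝ) - 1) + 1 ≤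
        (ramseyNumber (ellPathEdges 3 2 n) (transTournHyp χ m) : ℝ) := by
  intro n hn
  have h := nat_bound χ m n hχ hm hn
  obtain ⟨hR, -⟩ := exists_bad_tourn χ (by omega)
  have h1 : (((2 * (n / 3) - 1) * (dirRamsey χ - 1) + 1 : ℕ) : ℝ) ≤
      (ramseyNumber (ellPathEdges 3 2 n) (transTournHyp χ m) : ℝ) := by exact_mod_cast h
  refine le_trans ?_ h1
  have hs : (2 : ℝ) / 3 * n - 3 ≤ ((2 * (n / 3) - 1 : ℕ) : ℝ) := by
    have h2 : 2 * n ≤ 3 * (2 * (n / 3) - 1) + 9 := by omega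
    have h3 : (2 : ℝ) * n ≤ 3 * ((2 * (n / 3) - 1 : ℕ) : ℝ) + 9 := by exact_mod_cast h2
    linarith
  have hr : ((dirRamsey χ - 1 : ℕ) : ℝ) = (dirRamsey χ : ℝ) - 1 := by
    rw [Nat.cast_sub hR]; simp
  rw [Nat.cast_add, Nat.cast_mul, hr, Nat.cast_one]
  have hr0 : (0 : ℝ) ≤ (dirRamsey χ : ℝ) - 1 := by rw [← hr]; positivity
  have := mul_le_mul_of_nonneg_right hs hr0
  linarith
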